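/- Let (D, IC) be a database over a finite set of atoms. If N is a ≤_c-maximally consistent element of M^DB = { N | N ≥_k H^D ⊕ M for some two-valued model M of IC }, then (Insert^N, Retract^N) = (N^⊤ \ D, N^⊤ ∩ D) is a ≤_c-preferred repair of (D, IC). -/

import Mathlib

/-- Propositional formulas built from atoms using negation, conjunction and disjunction. -/
inductive Fmla (α : Type) : Type where
  | atom : α → Fmla α
  | neg  : Fmla α → Fmla α
  | conj : Fmla α → Fmla α → Fmla α
  | disj : Fmla α → Fmla α → Fmla α

/-- Two-valued satisfaction; a two-valued valuation is identified with its set of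
true atoms `M` (so `M^t = M`, and the minimal Herbrand model `H^D` is `D` itself). -/
def sat2 {α : Type} (M : Set α) : Fmla α → Prop
  | .atom p => p ∈ M
  | .neg φ => ¬ sat2 M φ
  | .conj φ ψ => sat2 M φ ∧ sat2 M ψ
  | .disj φ ψ => sat2 M φ ∨ sat2 M ψ

/-- `M` is a two-valued model of the set of formulas `T`. -/
def models2 {α : Type} (M : Set α) (T : Set (Fmla α)) : Prop := ∀ φ ∈ T, sat2 M φ

/-- `(D, IC)` is a database: `IC` is a finite, classically consistent set of formulas. -/
def IsDatabase {α : Type} (_D : Set α) (IC : Set (Fmla α)) : Prop :=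
  IC.Finite ∧ ∃ M : Set α, models2 M IC

/-- The database `(D, IC)` is consistent: every formula of `IC` follows from `D`,
i.e. is satisfied by the minimal Herbrand model of `D`. -/
def IsConsistentDB {α : Type} (D : Set α) (IC : Set (Fmla α)) : Prop := models2 D IC

/-- `(I, R)` is a repair of the database `(D, IC)`. -/
def IsRepair {α : Type} (D : Set α) (IC : Set (Fmla α)) (I R : Set α) : Prop :=
  I ∩ D = ∅ ∧ R ⊆ D ∧ IsConsistentDB ((D ∪ I) \ R) IC

/-- The three-valued structure THREE = {t, f, ⊤}. -/
inductive Three : Type where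
  | tt | ff | top
  deriving DecidableEq

namespace Three

/-- Position in the truth order `f ≤_t ⊤ ≤_t t`. -/
def rank : Three → ℕ
  | ff => 0 | top => 1 | tt => 2

/-- Conjunction: meet w.r.t. the truth order. -/
def and3 (a b : Three) : Three := if rank a ≤ rank b then a else b

/-- Disjunction: join w.r.t. the truth order. -/
def or3 (a b : Three) : Three := if rank a ≤ rank b then b else a

/-- Negation: swaps `t` and `f`, fixes `⊤`. -/
def neg3 : Three → Three | tt => ff | ff => tt | top => top

/-- `x ⊕ y`: the least upper bound w.r.t. the knowledge order. -/
def oplus (a b : Three) : Three := if a = b then a else top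

/-- The knowledge order `≤_k`: `f` and `t` incomparable, both below `⊤`. -/
def kle (a b : Three) : Prop := a = b ∨ b = top

/-- The designated truth values are `t` and `⊤`. -/
def designated (a : Three) : Prop := a ≠ ff

end Three

/-- Three-valued evaluation of formulas. -/
def eval3 {α : Type} (ν : α → Three) : Fmla α → Three
  | .atom p => ν p
  | .neg φ => Three.neg3 (eval3 ν φ)
  | .conj φ ψ => Three.and3 (eval3 ν φ) (eval3 ν ψ)
  | .disj φ ψ => Three.or3 (eval3 ν φ) (eval3 ν ψ)

/-- `ν` is a three-valued model of the set of formulas `T`. -/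
def models3 {α : Type} (ν : α → Three) (T : Set (Fmla α)) : Prop :=
  ∀ φ ∈ T, Three.designated (eval3 ν φ)

open Classical in
/-- The two-valued valuation with true-set `M`, viewed inside THREE. -/
noncomputable def toThree {α : Type} (M : Set α) (p : α) : Three :=
  if p ∈ M then Three.tt else Three.ff

/-- `ν^⊤`: the atoms assigned `⊤` by `ν`. -/
def topSet {α : Type} (ν : α → Three) : Set α := {p | ν p = Three.top}

/-- `ν ≥_k μ` pointwise. -/
def kge {α : Type} (ν μ : α → Three) : Prop := ∀ p, Three.kle (μ p) (ν p)

/-- The valuation `H^D ⊕ M` (pointwise `⊕`). -/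
noncomputable def herbOplus {α : Type} (D M : Set α) : α → Three :=
  fun p => Three.oplus (toThree D p) (toThree M p)

/-- `M^DB = { N | N ≥_k H^D ⊕ M for some two-valued model M of IC }`. -/
def MDB {α : Type} (D : Set α) (IC : Set (Fmla α)) : Set (α → Three) :=
  {N | ∃ M : Set α, models2 M IC ∧ kge N (herbOplus D M)}

/-- The atoms of `D`, viewed as formulas. -/
def atomsOf {α : Type} (D : Set α) : Set (Fmla α) := Fmla.atom '' D

/-- `(I, R)` is a `≤_i`-preferred repair of `(D, IC)`:
`(I', R') ≤_i (I, R)` iff `I ⊆ I'` and `R ⊆ R'`. -/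
def IsPreferredRepairI {α : Type} (D : Set α) (IC : Set (Fmla α)) (I R : Set α) : Prop :=
  IsRepair D IC I R ∧
    ∀ I' R', IsRepair D IC I' R' → (I' ⊆ I ∧ R' ⊆ R) → (I ⊆ I' ∧ R ⊆ R')

/-- `(I, R)` is a `≤_c`-preferred repair of `(D, IC)`:
`(I', R') ≤_c (I, R)` iff `|I| + |R| ≤ |I'| + |R'|`. -/
def IsPreferredRepairC {α : Type} (D : Set α) (IC : Set (Fmla α)) (I R : Set α) : Prop :=
  IsRepair D IC I R ∧
    ∀ I' R', IsRepair D IC I' R' → I'.ncard + R'.ncard ≤ I.ncard + R.ncard →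
      I.ncard + R.ncard ≤ I'.ncard + R'.ncard

/-- `N` is `≤_i`-maximally consistent in `S`: no `N' ∈ S` has `N'^⊤ ⊊ N^⊤`. -/
def MaxConsI {α : Type} (S : Set (α → Three)) (N : α → Three) : Prop :=
  N ∈ S ∧ ¬ ∃ N' ∈ S, topSet N' ⊂ topSet N

/-- `N` is `≤_c`-maximally consistent in `S`: no `N' ∈ S` has `#(N'^⊤) < #(N^⊤)`. -/
def MaxConsC {α : Type} (S : Set (α → Three)) (N : α → Three) : Prop :=
  N ∈ S ∧ ¬ ∃ N' ∈ S, (topSet N').ncard < (topSet N).ncard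

theorem mem_topSet_herbOplus {α : Type} (D M : Set α) (p : α) :
    p ∈ topSet (herbOplus D M) ↔ ¬ (p ∈ D ↔ p ∈ M) := by
  by_cases h1 : p ∈ D <;> by_cases h2 : p ∈ M <;>
    simp [topSet, herbOplus, toThree, Three.oplus, h1, h2]

theorem herbOplus_mem_MDB {α : Type} (D M : Set α) (IC : Set (Fmla α)) (h : models2 M IC) :
    herbOplus D M ∈ MDB D IC := ⟨M, h, fun _ => Or.inl rfl⟩

/-- over a finite set of atoms, if `N` is `≤_c`-maximally consistent
in `M^DB`, then `(N^⊤ \ D, N^⊤ ∩ D)` is a `≤_c`-preferred repair of `(D, IC)`. -/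
theorem preferredC_of_maxConsC {α : Type} [Fintype α] (D : Set α) (IC : Set (Fmla α))
    (hDB : IsDatabase D IC) (N : α → Three) (hN : MaxConsC (MDB D IC) N) :
    IsPreferredRepairC D IC (topSet N \ D) (topSet N ∩ D) := by
  obtain ⟨⟨M, hM, hk⟩, hmin⟩ := hN
  have hmin' : ∀ M', models2 M' IC → (topSet N).ncard ≤ (topSet (herbOplus D M')).ncard := by
    intro M' h'
    by_contra hc
    exact hmin ⟨_, herbOplus_mem_MDB D M' IC h', not_le.mp hc⟩
  have hsub : topSet (herbOplus D M) ⊆ topSet N := by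
    intro p hp
    rcases hk p with h | h
    · exact h.symm.trans hp
    · exact h
  have heq : topSet (herbOplus D M) = topSet N :=
    Set.eq_of_subset_of_ncard_le hsub (hmin' M hM) (Set.toFinite _)
  have hcard : (topSet N \ D).ncard + (topSet N ∩ D).ncard = (topSet N).ncard := by
    rw [add_comm]
    exact Set.ncard_inter_add_ncard_sdiff_eq_ncard _ _ (Set.toFinite _)
  refine ⟨⟨by ext p; simp, Set.inter_subset_right, ?_⟩, ?_⟩
  · have : (D ∪ (topSet N \ D)) \ (topSet N ∩ D) = M := by
      ext p
      have := mem_topSet_herbOplus D M p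
      rw [heq] at this
      simp only [Set.mem_sdiff, Set.mem_union, Set.mem_inter_iff, this]
      tauto
    rw [this]
    exact hM
  · rintro I' R' ⟨-, -, hc⟩ -
    rw [hcard]
    refine (hmin' _ hc).trans (le_trans (Set.ncard_le_ncard ?_ (Set.toFinite _))
      (Set.ncard_union_le I' R'))
    intro p hp
    rw [mem_topSet_herbOplus] at hp
    simp only [Set.mem_sdiff, Set.mem_union] at hp ⊢
    tauto
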